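/- Let G be a finite group. Then o(G) = 31/12 if and only if G is isomorphic to the alternating group A_4. -/

import Mathlib

/-- The sum of the orders of all elements of `G`. -/
noncomputable def psi (G : Type*) [Group G] : ℕ := ∑ᶠ x : G, orderOf x

/-- The average order of a finite group `G`, as a rational number. -/
noncomputable def avgOrder (G : Type*) [Group G] : ℚ := psi G / Nat.card G

/-- The number of elements of order `d` in `G`. -/
noncomputable def nOrd (G : Type*) [Group G] (d : ℕ) : ℕ := Nat.card {x : G // orderOf x = d}

/-- A group is supersolvable if it has a chain of subgroups
`⊥ = H 0 ≤ H 1 ≤ … ≤ H n = ⊤`, each normal in `G`, with all successive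
quotients cyclic. -/
def IsSupersolvable (G : Type*) [Group G] : Prop :=
  ∃ (n : ℕ) (H : Fin (n + 1) → Subgroup G) (hnorm : ∀ i, (H i).Normal),
    H 0 = ⊥ ∧ H (Fin.last n) = ⊤ ∧
    (∀ i : Fin n, H i.castSucc ≤ H i.succ) ∧
    ∀ i : Fin n,
      letI := (hnorm i.castSucc).subgroupOf (H i.succ)
      IsCyclic (↥(H i.succ) ⧸ (H i.castSucc).subgroupOf (H i.succ))

open Subgroup

theorem psi_eq_sum (G : Type*) [Group G] [Fintype G] : psi G = ∑ x : G, orderOf x :=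
  finsum_eq_sum_of_fintype _

theorem psi_congr {G H : Type*} [Group G] [Group H] (e : G ≃* H) : psi G = psi H :=
  finsum_eq_of_bijective e e.bijective fun x => (orderOf_injective e.toMonoidHom e.injective x).symm

theorem psi_alternatingGroup_four : psi (alternatingGroup (Fin 4)) = 31 := by
  have key : ∀ x : alternatingGroup (Fin 4),
      orderOf x = if x = 1 then 1 else if x ^ 2 = 1 then 2 else 3 := by
    intro x
    have hx : x ^ 2 = 1 ∨ x ^ 3 = 1 := by
      revert x
      decide
    split_ifs with h1 h2
    · simp [h1]
    · exact orderOf_eq_prime h2 h1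
    · exact orderOf_eq_prime (hx.resolve_left h2) h1
  rw [psi_eq_sum, Finset.sum_congr rfl fun x _ => key x]
  decide

theorem odd_psi (G : Type*) [Group G] [Finite G] : Odd (psi G) := by
  classical
  have := Fintype.ofFinite G
  have h0 : ∑ x ∈ Finset.univ.erase (1 : G), (orderOf x : ZMod 2) = 0 := by
    refine Finset.sum_involution (fun x _ => x⁻¹) ?_ ?_ ?_ ?_
    · intro x _
      rw [orderOf_inv]
      exact CharTwo.add_self_eq_zero _
    · intro x hx hne h
      apply hne
      have h2 : orderOf x = 2 := by
        refine orderOf_eq_prime ?_ (Finset.ne_of_mem_erase hx)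
        rw [pow_two]
        nth_rewrite 1 [← h]
        exact inv_mul_cancel x
      rw [h2]
      rfl
    · intro x hx
      simpa using hx
    · intro x _
      exact inv_inv x
  rw [← ZMod.natCast_eq_one_iff_odd, psi_eq_sum, Nat.cast_sum,
    ← Finset.add_sum_erase _ _ (Finset.mem_univ (1 : G)), h0]
  simp

theorem card_isConj_mul_card_centralizer {G : Type*} [Group G] [Finite G] (g : G) :
    Nat.card {x : G // IsConj x g} * Nat.card (centralizer {g}) = Nat.card G := by
  rw [nat_card_centralizer_nat_card_stabilizer, mul_comm,
    Nat.card_congr (ConjAct.toConjAct (G := G)).toEquiv,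
    ← (MulAction.stabilizer (ConjAct G) g).card_mul_index, MulAction.index_stabilizer,
    ← Nat.card_coe_set_eq]
  congr 1
  exact Nat.card_congr (Equiv.subtypeEquivRight fun x => ConjAct.mem_orbit_conjAct.symm)

/-- A group of order 12 all of whose elements have order at most 3 is isomorphic to `A₄`. -/
theorem nonempty_mulEquiv_alternatingGroup_four {G : Type*} [Group G] (hG : Nat.card G = 12)
    (ho : ∀ x : G, orderOf x ≤ 3) : Nonempty (G ≃* alternatingGroup (Fin 4)) := by
  have : Finite G := Nat.finite_of_card_ne_zero (by omega)
  have : Fact (Nat.Prime 3) := ⟨Nat.prime_three⟩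
  obtain ⟨Q, hQ⟩ := Sylow.exists_subgroup_card_pow_prime (G := G) 3 (n := 1) (by rw [hG]; decide)
  rw [pow_one] at hQ
  have hcore : Q.normalCore = ⊥ := by
    rw [eq_bot_iff]
    intro g hg
    by_contra hg1
    rw [mem_bot] at hg1
    have hclass : Nat.card {x : G // IsConj x g} ≤ 2 := by
      have hinj : Function.Injective
          (fun x : {x : G // IsConj x g} =>
            (⟨⟨x.1, Q.normalCore_le (by
              obtain ⟨c, hc⟩ := isConj_iff.1 x.2.symm
              rw [← hc]
              exact Q.normalCore_normal.conj_mem g hg c)⟩, fun h => hg1 (by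
                have h1 : x.1 = 1 := congrArg Subtype.val h
                have h2 := x.2
                rw [h1] at h2
                exact isConj_one_right.1 h2)⟩ : {y : Q // y ≠ 1})) := by
        intro x y h
        simpa [Subtype.ext_iff] using h
      have := Nat.card_le_card_of_injective _ hinj
      refine this.trans ?_
      have := Fintype.ofFinite Q
      classical
      rw [Nat.card_eq_fintype_card, Fintype.card_subtype_compl, ← Nat.card_eq_fintype_card, hQ]
      simp
    have hmul := card_isConj_mul_card_centralizer g
    rw [hG] at hmul
    have h2 : 2 ∣ Nat.card (centralizer {g}) := by
      interval_cases Nat.card {x : G // IsConj x g} <;> omega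
    have : Fact (Nat.Prime 2) := ⟨Nat.prime_two⟩
    obtain ⟨t, ht⟩ := exists_prime_orderOf_dvd_card' 2 h2
    have hg3 : orderOf g = 3 := by
      refine orderOf_eq_prime ?_ hg1
      have := pow_card_eq_one' (x := (⟨g, Q.normalCore_le hg⟩ : Q))
      rw [hQ] at this
      simpa [Subtype.ext_iff] using this
    have hcomm : Commute g t := (mem_centralizer_iff.1 t.2 g rfl)
    have h6 := hcomm.orderOf_mul_eq_mul_orderOf_of_coprime (by
      rw [hg3, orderOf_coe, ht]; norm_num)
    rw [hg3, orderOf_coe, ht] at h6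
    have := ho (g * t)
    omega
  have hindex : Nat.card (G ⧸ Q) = 4 := by
    have := Q.card_mul_index
    rw [hG] at this
    change Q.index = 4
    rw [hQ] at this
    omega
  rw [normalCore_eq_ker] at hcore
  let e : G ⧸ Q ≃ Fin 4 := Finite.equivFinOfCardEq hindex
  let φ : G →* Equiv.Perm (Fin 4) :=
    e.permCongrHom.toMonoidHom.comp (MulAction.toPermHom G (G ⧸ Q))
  have hφ : Function.Injective φ :=
    e.permCongrHom.injective.comp ((MonoidHom.ker_eq_bot_iff _).1 hcore)
  have hrange : φ.range = alternatingGroup (Fin 4) := by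
    apply Equiv.Perm.eq_alternatingGroup_of_index_eq_two
    have h := φ.range.card_mul_index
    rw [← Nat.card_congr (MonoidHom.ofInjective hφ).toEquiv, hG, Nat.card_perm] at h
    simp [Nat.factorial] at h
    omega
  exact ⟨(MonoidHom.ofInjective hφ).trans (MulEquiv.subgroupCongr hrange)⟩

/-- If all involutions are conjugate to one commuting with a subgroup of order 4, then at most
a quarter of the elements are involutions. -/
theorem four_mul_card_involution_le {G : Type*} [Group G] [Finite G] {P : Subgroup G}
    (hP : Nat.card P = 4) {t : G} (ht : P ≤ centralizer {t})
    (hconj : ∀ x : G, orderOf x = 2 → IsConj x t) :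
    4 * Nat.card {x : G // orderOf x = 2} ≤ Nat.card G := by
  have h1 : Nat.card {x : G // orderOf x = 2} ≤ Nat.card {x : G // IsConj x t} :=
    Nat.card_le_card_of_injective (Subtype.map id hconj)
      (Subtype.map_injective _ Function.injective_id)
  have h2 : 4 ≤ Nat.card (centralizer {t}) := hP ▸ card_le_of_le ht
  rw [← card_isConj_mul_card_centralizer t, mul_comm]
  exact Nat.mul_le_mul h1 h2

/-- Lower bound for `ψ(G)` in terms of the number of involutions. -/
theorem le_psi_add_card_involution {G : Type*} [Group G] [Finite G] (g : G) :
    3 * Nat.card G + (orderOf g - 3) ≤ psi G + Nat.card {x : G // orderOf x = 2} + 2 := by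
  classical
  have := Fintype.ofFinite G
  have h : ∑ x : G, (3 + if x = g then orderOf g - 3 else 0) ≤
      ∑ x : G, (orderOf x + (if orderOf x = 2 then 1 else 0) + if x = 1 then 2 else 0) := by
    refine Finset.sum_le_sum fun x _ => ?_
    have hpos := orderOf_pos x
    have h1 : x = 1 ↔ orderOf x = 1 := orderOf_eq_one_iff.symm
    rw [if_congr h1 rfl rfl]
    split_ifs with hx <;> first | subst hx; omega | omega
  simp only [Finset.sum_add_distrib, Finset.sum_ite_eq', Finset.mem_univ, if_true,
    Finset.sum_const, smul_eq_mul, Finset.card_univ, Finset.sum_boole, Nat.cast_id] at h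
  rw [psi_eq_sum, Nat.card_eq_fintype_card, Nat.card_eq_fintype_card, Fintype.card_subtype,
    mul_comm]
  exact h

theorem eq_or_eq_of_card_eq_four {G : Type*} [Group G] [Finite G] {P : Subgroup G}
    (hP : Nat.card P = 4) {x y z : G} (hx : x ∈ P) (hy : y ∈ P) (hz : z ∈ P) (hx1 : x ≠ 1)
    (hy1 : y ≠ 1) (hz1 : z ≠ 1) (hxy : x ≠ y) (hxz : x ≠ z) (hyz : y ≠ z) {p : G} (hp : p ∈ P) :
    p = 1 ∨ p = x ∨ p = y ∨ p = z := by
  classical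
  have hcard : ({1, x, y, z} : Finset G).card = 4 := by
    simp [Finset.card_insert_of_notMem, hx1.symm, hy1.symm, hz1.symm, hxy, hxz, hyz]
  have hsub : (({1, x, y, z} : Finset G) : Set G) ⊆ P := by
    simp [Set.insert_subset_iff, hx, hy, hz, P.one_mem]
  have heq := Set.eq_of_subset_of_ncard_le hsub (by
    rw [Set.ncard_coe_finset, hcard, ← Nat.card_coe_set_eq]
    exact hP.le)
  have hp' : p ∈ (P : Set G) := hp
  rw [← heq] at hp'
  simpa using hp'

theorem mul_comm_of_card_eq_four {G : Type*} [Group G] {P : Subgroup G}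
    (hP : Nat.card P = 4) {x y : G} (hx : x ∈ P) (hy : y ∈ P) : x * y = y * x := by
  have : Fact (Nat.Prime 2) := ⟨Nat.prime_two⟩
  have h := IsPGroup.isMulCommutative_of_card_eq_prime_sq (p := 2) (G := P) hP
  exact congrArg Subtype.val (h.is_comm.comm ⟨x, hx⟩ ⟨y, hy⟩)

/-- If two involutions of a Sylow 2-subgroup `P` of order 4 are not conjugate, then `P` is
central in its normalizer. -/
theorem normalizer_le_centralizer_of_not_isConj {G : Type*} [Group G] [Finite G] (P : Sylow 2 G)
    (hP : Nat.card (P : Subgroup G) = 4) {s t : G} (hs : s ∈ P) (ht : t ∈ P) (hs1 : s ≠ 1)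
    (ht1 : t ≠ 1) (hst : ¬ IsConj s t) : normalizer (P : Set G) ≤ centralizer (P : Set G) := by
  have : Fact (Nat.Prime 2) := ⟨Nat.prime_two⟩
  intro g hg
  rw [mem_centralizer_iff]
  intro x hx
  by_contra hgx
  have hconj : ∀ y ∈ P, g * y * g⁻¹ ∈ P := fun y hy => (mem_normalizer_iff.1 hg y).1 hy
  obtain ⟨y, hy⟩ : ∃ y, y = g * x * g⁻¹ := ⟨_, rfl⟩
  obtain ⟨z, hz⟩ : ∃ z, z = g * y * g⁻¹ := ⟨_, rfl⟩
  have hyP : y ∈ P := hy ▸ hconj x hx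
  have hzP : z ∈ P := hz ▸ hconj y hyP
  have hxy : x ≠ y := fun h => hgx (eq_mul_inv_iff_mul_eq.1 (h.trans hy))
  have hyz : y ≠ z := by
    intro h
    rw [hz, hy] at h
    exact hxy (by simpa [hy] using h)
  have hx1 : x ≠ 1 := fun h => hxy (by simp [hy, h])
  have hy1 : y ≠ 1 := by simpa [hy] using hx1
  have hz1 : z ≠ 1 := by simpa [hz] using hy1
  have hxz : x ≠ z := by
    intro h
    have hsq : Commute (g ^ 2) x := by
      have : g * (g * x * g⁻¹) * g⁻¹ = x := by rw [← hy, ← hz, h]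
      rw [commute_iff_eq, ← mul_inv_eq_iff_eq_mul, pow_two]
      simpa [mul_assoc] using this
    have hodd : Odd (P : Subgroup G).index :=
      Nat.not_even_iff_odd.1 fun h => P.not_dvd_index h.two_dvd
    have hmem : g ^ (P : Subgroup G).index ∈ P := by
      have hp : IsPGroup 2 (zpowers (g ^ (P : Subgroup G).index)) := by
        refine IsPGroup.of_card_dvd_pow (n := 2) ?_
        rw [Nat.card_zpowers]
        apply orderOf_dvd_of_pow_eq_one
        rw [← pow_mul, show (2 : ℕ) ^ 2 = Nat.card (P : Subgroup G) from hP.symm,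
          mul_comm, card_mul_index, pow_card_eq_one']
      have hle : zpowers (g ^ (P : Subgroup G).index) ≤ normalizer (P : Set G) :=
        zpowers_le.2 (pow_mem hg _)
      have := hp.inf_normalizer_sylow P
      rw [inf_eq_left.2 hle] at this
      exact inf_eq_left.1 this.symm (mem_zpowers _)
    have hcomm : Commute (g ^ (P : Subgroup G).index) x := mul_comm_of_card_eq_four hP hmem hx
    obtain ⟨j, hj⟩ := hodd
    rw [hj, pow_succ, pow_mul] at hcomm
    have hgx' : Commute g x := by
      have := (hsq.pow_left j).inv_left.mul_left hcomm
      rwa [inv_mul_cancel_left] at this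
    exact hgx hgx'.symm
  have hcxy : IsConj x y := isConj_iff.2 ⟨g, hy.symm⟩
  have hcyz : IsConj y z := isConj_iff.2 ⟨g, hz.symm⟩
  have hall : ∀ p ∈ P, p ≠ 1 → IsConj p y := by
    intro p hp hp1
    rcases eq_or_eq_of_card_eq_four hP hx hyP hzP hx1 hy1 hz1 hxy hxz hyz hp with
      rfl | rfl | rfl | rfl
    · exact absurd rfl hp1
    · exact hcxy
    · exact IsConj.refl _
    · exact hcyz.symm
  exact hst ((hall s hs hs1).trans (hall t ht ht1).symm)

/-- Let `P` be a Sylow 2-subgroup that is a Klein four-group central in its normalizer. If 12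
divides the order of the group, then its average order exceeds `31/12`. -/
theorem lt_psi_of_normalizer_le_centralizer {G : Type*} [Group G] [Finite G] (P : Sylow 2 G)
    (hP : Nat.card (P : Subgroup G) = 4) (hexp : ∀ x ∈ P, x ^ 2 = 1)
    (hN : normalizer (P : Set G) ≤ centralizer (P : Set G)) (hG : 12 ∣ Nat.card G) :
    31 * Nat.card G < 12 * psi G := by
  classical
  have : Fact (Nat.Prime 2) := ⟨Nat.prime_two⟩
  have := Fintype.ofFinite G
  obtain ⟨K, hK⟩ : ∃ K, K = (MonoidHom.transferSylow P hN).ker := ⟨_, rfl⟩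
  have hcompl : IsComplement' K P := hK ▸ MonoidHom.ker_transferSylow_isComplement' P hN
  have hK2 : ¬ 2 ∣ Nat.card K := hK ▸ MonoidHom.not_dvd_card_ker_transferSylow P hN
  have hKsq : ∀ y ∈ K, y ^ 2 = 1 → y = 1 := by
    intro y hy h2
    by_contra h1
    apply hK2
    rw [← orderOf_eq_prime h2 h1]
    exact K.orderOf_dvd_natCard hy
  have hsqK : ∀ y, y ^ 2 ∈ K := by
    intro y
    rw [hK, MonoidHom.mem_ker, map_pow]
    exact Subtype.ext (hexp _ (MonoidHom.transferSylow P hN y).2)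
  have horder : ∀ y ∉ K, orderOf y = 2 ∨ 6 ≤ orderOf y := by
    intro y hy
    have hodd : ¬ Odd (orderOf y) := by
      rintro ⟨j, hj⟩
      have h := pow_orderOf_eq_one y
      rw [hj, pow_succ, pow_mul, mul_eq_one_iff_inv_eq] at h
      exact hy (h ▸ inv_mem (pow_mem (hsqK y) j))
    have h4 : orderOf y ≠ 4 := by
      intro h
      have h2 : y ^ 2 = 1 := by
        refine hKsq _ (hsqK y) ?_
        rw [← pow_mul, show 2 * 2 = orderOf y from h.symm, pow_orderOf_eq_one]
      have := orderOf_dvd_of_pow_eq_one h2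
      rw [h] at this
      omega
    have hpos := orderOf_pos y
    rw [Nat.odd_iff] at hodd
    omega
  have hmulK : ∀ k ∈ K, ∀ p ∈ P, p ≠ 1 → k * p ∉ K := by
    intro k hk p hp hp1 h
    exact hp1 (hKsq p ((K.mul_mem_cancel_left hk).1 h) (hexp p hp))
  have hexists : ∀ S : Finset (P : Subgroup G), S.card < 4 → ∃ p, p ∉ S := by
    intro S hS
    by_contra! h
    rw [Finset.eq_univ_iff_forall.2 h, Finset.card_univ, ← Nat.card_eq_fintype_card, hP] at hS
    exact lt_irrefl _ hS
  have hbad : ∀ k ∈ K, k ≠ 1 → ∃ p : (P : Subgroup G), p ≠ 1 ∧ 6 ≤ orderOf (k * (p : G)) := by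
    intro k hk hk1
    by_contra! h
    have hinv : ∀ p : (P : Subgroup G), p ≠ 1 → (p : G) * k * (p : G)⁻¹ = k⁻¹ := by
      intro p hp
      have h2 : orderOf (k * (p : G)) = 2 :=
        (horder _ (hmulK k hk p p.2 (by simpa using hp))).resolve_right (h p hp).not_ge
      have h3 := pow_orderOf_eq_one (k * (p : G))
      have h4 := hexp p p.2
      rw [h2, pow_two] at h3
      rw [pow_two, mul_eq_one_iff_eq_inv] at h4
      rw [← h4]
      exact eq_inv_of_mul_eq_one_right (by simpa only [mul_assoc] using h3)
    obtain ⟨p, hp⟩ := hexists {1} (by simp)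
    obtain ⟨q, hq⟩ := hexists {1, p} (lt_of_le_of_lt Finset.card_le_two (by norm_num))
    simp only [Finset.mem_singleton, Finset.mem_insert, not_or] at hp hq
    have hpq : p * q ≠ 1 := by
      intro h1
      have h2 : p * p = 1 := Subtype.ext (by simpa [pow_two] using hexp p p.2)
      exact hq.2 (mul_left_cancel (h1.trans h2.symm))
    have h1 := hinv _ hpq
    have h2 : (p : G) * (q * k * (q : G)⁻¹) * (p : G)⁻¹ = k := by
      rw [hinv q hq.1]
      simpa [mul_assoc] using congrArg (·⁻¹) (hinv p hp)
    have h3 : k = k⁻¹ := by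
      rw [← h1]
      nth_rewrite 1 [← h2]
      push_cast
      group
    exact hk1 (hKsq k hk (by rw [pow_two]; nth_rewrite 1 [h3]; exact inv_mul_cancel k))
  have hrow : ∀ k : K, 13 ≤ ∑ p : (P : Subgroup G), orderOf ((k : G) * p) +
      if k = 1 then 6 else 0 := by
    intro k
    have hcard : Fintype.card (P : Subgroup G) = 4 := by rw [← Nat.card_eq_fintype_card, hP]
    have htwo : ∀ p : (P : Subgroup G), p ≠ 1 → 2 ≤ orderOf ((k : G) * p) := by
      intro p hp
      have := horder _ (hmulK k k.2 p p.2 (by simpa using hp))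
      omega
    split_ifs with hk
    · have h : ∑ p : (P : Subgroup G), 2 ≤
          ∑ p : (P : Subgroup G), (orderOf ((k : G) * p) + if p = 1 then 1 else 0) := by
        refine Finset.sum_le_sum fun p _ => ?_
        have hpos := orderOf_pos ((k : G) * p)
        split_ifs with hp
        · omega
        · exact htwo p hp
      simp only [Finset.sum_add_distrib, Finset.sum_ite_eq', Finset.mem_univ, if_true,
        Finset.sum_const, smul_eq_mul, Finset.card_univ, hcard] at h
      omega
    · have hk1 : (k : G) ≠ 1 := by simpa using hk
      obtain ⟨p₀, hp₀, h6⟩ := hbad k k.2 hk1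
      have h : ∑ p : (P : Subgroup G), (2 + (if p = 1 then 1 else 0) + if p = p₀ then 4 else 0) ≤
          ∑ p : (P : Subgroup G), orderOf ((k : G) * p) := by
        refine Finset.sum_le_sum fun p _ => ?_
        by_cases hp : p = 1
        · have h1 : orderOf (k : G) ≠ 1 := by simpa using hk
          have h2 : orderOf (k : G) ≠ 2 := fun h2 =>
            hk1 (hKsq k k.2 (by rw [← h2, pow_orderOf_eq_one]))
          have := orderOf_pos (k : G)
          simp only [hp, hp₀.symm, if_true, if_false, OneMemClass.coe_one, mul_one]
          omega
        · have := htwo p hp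
          by_cases hpp : p = p₀
          · simp only [hpp, hp₀, if_true, if_false]
            omega
          · simpa only [hp, hpp, if_false]
      simp only [Finset.sum_add_distrib, Finset.sum_ite_eq', Finset.mem_univ, if_true,
        Finset.sum_const, smul_eq_mul, Finset.card_univ, hcard] at h
      omega
  have hsum : psi G = ∑ k : K, ∑ p : (P : Subgroup G), orderOf ((k : G) * p) := by
    rw [psi_eq_sum, ← hcompl.sum_comp orderOf]
    exact Fintype.sum_prod_type _
  have htotal := Finset.sum_le_sum fun (k : K) (_ : k ∈ Finset.univ) => hrow k
  simp only [Finset.sum_add_distrib, Finset.sum_ite_eq', Finset.mem_univ, if_true,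
    Finset.sum_const, smul_eq_mul, Finset.card_univ] at htotal
  rw [← hsum, ← Nat.card_eq_fintype_card] at htotal
  have hcardG := hcompl.card_mul_card
  have hKpos : 0 < Nat.card K := Nat.card_pos
  rw [hP] at hcardG
  omega

theorem nonempty_mulEquiv_of_psi_eq {G : Type*} [Group G] [Finite G]
    (h : 12 * psi G = 31 * Nat.card G) : Nonempty (G ≃* alternatingGroup (Fin 4)) := by
  have : Fact (Nat.Prime 2) := ⟨Nat.prime_two⟩
  have hodd := odd_psi G
  rw [Nat.odd_iff] at hodd
  have hpos : 0 < Nat.card G := Nat.card_pos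
  have h12 : 12 ∣ Nat.card G := by omega
  obtain ⟨P⟩ : Nonempty (Sylow 2 G) := inferInstance
  have hP : Nat.card (P : Subgroup G) = 4 := by
    have h1 : (P : Subgroup G).index % 2 = 1 := by
      have := P.not_dvd_index
      omega
    have h2 := (P : Subgroup G).card_mul_index
    obtain ⟨j, hj⟩ := IsPGroup.iff_card.1 P.isPGroup'
    rw [hj]
    rw [hj] at h2
    match j with
    | 0 | 1 => omega
    | 2 => rfl
    | i + 3 =>
      rw [pow_add, mul_right_comm] at h2
      omega
  obtain ⟨t, ht⟩ := exists_prime_orderOf_dvd_card' (G := (P : Subgroup G)) 2 (by rw [hP]; norm_num)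
  rw [← orderOf_coe] at ht
  by_cases hfus : ∀ x ∈ P, orderOf x = 2 → IsConj x t
  · have hconj : ∀ x : G, orderOf x = 2 → IsConj x t := by
      intro x hx
      obtain ⟨Q, hQ⟩ := IsPGroup.exists_le_sylow (P := zpowers x)
        (IsPGroup.of_card (p := 2) (n := 1) (by rw [Nat.card_zpowers, hx, pow_one]))
      obtain ⟨g, hg⟩ := MulAction.exists_smul_eq G Q P
      have hmem : g * x * g⁻¹ ∈ P := by
        rw [← hg]
        exact Set.smul_mem_smul_set (a := MulAut.conj g) (hQ (mem_zpowers x))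
      have hxc : IsConj x (g * x * g⁻¹) := isConj_iff.2 ⟨g, rfl⟩
      refine hxc.trans (hfus _ hmem ?_)
      rw [← hx]
      exact (MulAut.conj g).orderOf_eq x
    have hle : (P : Subgroup G) ≤ centralizer {(t : G)} := by
      intro p hp
      rw [mem_centralizer_singleton_iff]
      exact mul_comm_of_card_eq_four hP hp t.2
    have hinv := four_mul_card_involution_le hP hle hconj
    refine nonempty_mulEquiv_alternatingGroup_four ?_ fun x => ?_
    · have := le_psi_add_card_involution (1 : G)
      omega
    · have := le_psi_add_card_involution x
      omega
  · push Not at hfus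
    obtain ⟨s, hs, hs2, hst⟩ := hfus
    have hs1 : s ≠ 1 := by
      rintro rfl
      simp at hs2
    have ht1 : (t : G) ≠ 1 := by
      intro h1
      simp [h1] at ht
    have hss : s * s = 1 := by rw [← pow_two, ← hs2, pow_orderOf_eq_one]
    have htt : (t : G) * t = 1 := by rw [← pow_two, orderOf_dvd_iff_pow_eq_one.1 ht.dvd]
    have hne : s ≠ t := by
      rintro rfl
      exact hst (IsConj.refl _)
    have hmul1 : s * t ≠ 1 := fun h1 => hne (mul_right_cancel (h1.trans htt.symm))
    have hexp : ∀ x ∈ P, x ^ 2 = 1 := by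
      intro x hx
      rw [pow_two]
      rcases eq_or_eq_of_card_eq_four hP hs t.2 (mul_mem hs t.2) hs1 ht1 hmul1 hne
        (by simpa using ht1) (by simpa using hs1) hx with rfl | rfl | rfl | rfl
      · exact mul_one 1
      · exact hss
      · exact htt
      · nth_rewrite 1 [mul_comm_of_card_eq_four hP hs t.2]
        rw [mul_assoc, ← mul_assoc s, hss, one_mul, htt]
    have := lt_psi_of_normalizer_le_centralizer P hP hexp
      (normalizer_le_centralizer_of_not_isConj P hP hs t.2 hs1 ht1 hst) h12
    omega

/-- A finite group `G` satisfies `o(G) = 31/12` if and only if `G ≅ A₄`. -/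
theorem stmt_1 (G : Type*) [Group G] [Finite G] :
    avgOrder G = 31 / 12 ↔ Nonempty (G ≃* alternatingGroup (Fin 4)) := by
  constructor
  · intro h
    apply nonempty_mulEquiv_of_psi_eq
    have hpos : (Nat.card G : ℚ) ≠ 0 := by exact_mod_cast Nat.card_pos.ne'
    rw [avgOrder, div_eq_div_iff hpos (by norm_num)] at h
    rw [mul_comm]
    exact_mod_cast h
  · rintro ⟨e⟩
    have hcard : Nat.card (alternatingGroup (Fin 4)) = 12 := by
      rw [nat_card_alternatingGroup]
      simp [Nat.factorial]
    rw [avgOrder, psi_congr e, Nat.card_congr e.toEquiv, psi_alternatingGroup_four, hcard]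
    norm_num
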